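/- (Necessity of the local testing condition.) Let 1 < p ≤ q < ∞, let τ = (τ_Q)_{Q∈𝒬} be nonnegative constants, and let σ, ω be weights on ℝ^d. Suppose there is 𝔑 < ∞ such that ω({x : T_τ(fσ)(x) > λ}) ≤ (𝔑 ‖f‖_{L^p(σ)} / λ)^q for all λ > 0 and all nonnegative f ∈ L^p(σ). Then for every dyadic cube R with ω(R) > 0, ‖T^in_{τ,R}(1_R ω)‖_{L^{p'}(σ)} ≤ C(p,q) · 𝔑 · ω(R)^{1/q'}, where p' = p/(p−1), q' = q/(q−1). -/

import Mathlib

open MeasureTheory ENNReal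

noncomputable section

/-- Index set for dyadic cubes of `ℝ^d`: a scale `k : ℤ` and a position `n ∈ ℤ^d`. -/
abbrev DIdx (d : ℕ) : Type := ℤ × (Fin d → ℤ)

/-- The dyadic cube `∏_j [2^k n_j, 2^k (n_j + 1))` of `ℝ^d`. -/
def dcube {d : ℕ} (i : DIdx d) : Set (Fin d → ℝ) :=
  {x | ∀ j, x j ∈ Set.Ico ((2 : ℝ) ^ i.1 * (i.2 j : ℝ)) ((2 : ℝ) ^ i.1 * ((i.2 j : ℝ) + 1))}

/-- The dyadic parent of a dyadic cube: the minimal dyadic cube strictly containing it. -/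
def dparent {d : ℕ} (i : DIdx d) : DIdx d :=
  (i.1 + 1, fun j => Int.fdiv (i.2 j) 2)

/-- The measure `ω dx` on `ℝ^d` associated with a weight `ω`. -/
def wMeasure {d : ℕ} (ω : (Fin d → ℝ) → ℝ≥0∞) : Measure (Fin d → ℝ) :=
  volume.withDensity ω

/-- The average of a nonnegative function `f` over the dyadic cube indexed by `i`,
with respect to the measure `μ`. -/
def cavg {d : ℕ} (μ : Measure (Fin d → ℝ)) (i : DIdx d) (f : (Fin d → ℝ) → ℝ≥0∞) : ℝ≥0∞ :=
  (∫⁻ x in dcube i, f x ∂μ) / μ (dcube i)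

/-- Lebesgue average of a nonnegative function over a dyadic cube. -/
def lavg {d : ℕ} (i : DIdx d) (f : (Fin d → ℝ) → ℝ≥0∞) : ℝ≥0∞ :=
  cavg volume i f

/-- The `L^p` norm (real exponent `p`) of a nonnegative function with respect to `μ`. -/
def lpn {d : ℕ} (p : ℝ) (μ : Measure (Fin d → ℝ)) (f : (Fin d → ℝ) → ℝ≥0∞) : ℝ≥0∞ :=
  (∫⁻ x, f x ^ p ∂μ) ^ (1 / p)

/-- The positive dyadic operator `T_τ f = ∑_Q τ_Q (E_Q f) 1_Q`. -/
def Tdy {d : ℕ} (τ : DIdx d → ℝ≥0∞) (f : (Fin d → ℝ) → ℝ≥0∞) (x : Fin d → ℝ) : ℝ≥0∞ :=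
  ∑' i : DIdx d, (dcube i).indicator (fun _ => τ i * lavg i f) x

/-- The local part `T^in_{τ,R} f = ∑_{Q ⊆ R} τ_Q (E_Q f) 1_Q`. -/
def TdyIn {d : ℕ} (τ : DIdx d → ℝ≥0∞) (R : DIdx d) (f : (Fin d → ℝ) → ℝ≥0∞)
    (x : Fin d → ℝ) : ℝ≥0∞ :=
  ∑' i : {i : DIdx d // dcube i ⊆ dcube R},
    (dcube i.1).indicator (fun _ => τ i.1 * lavg i.1 f) x

/-- The global part `T^out_{τ,R} f = ∑_{Q ⊇ R} τ_Q (E_Q f) 1_Q`. -/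
def TdyOut {d : ℕ} (τ : DIdx d → ℝ≥0∞) (R : DIdx d) (f : (Fin d → ℝ) → ℝ≥0∞)
    (x : Fin d → ℝ) : ℝ≥0∞ :=
  ∑' i : {i : DIdx d // dcube R ⊆ dcube i},
    (dcube i.1).indicator (fun _ => τ i.1 * lavg i.1 f) x

/-- The local testing constant `⟦σ,ω⟧^Loc_{τ,p,q}
= sup_{R : ω(R)>0} ω(R)^{-1/q'} ‖T^in_{τ,R}(1_R ω)‖_{L^{p'}(σ)}`. -/
def locTest {d : ℕ} (p q : ℝ) (τ : DIdx d → ℝ≥0∞) (σ ω : (Fin d → ℝ) → ℝ≥0∞) : ℝ≥0∞ :=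
  ⨆ (R : DIdx d) (_ : wMeasure ω (dcube R) ≠ 0),
    wMeasure ω (dcube R) ^ (-(1 / (q / (q - 1)))) *
      lpn (p / (p - 1)) (wMeasure σ) (TdyIn τ R ((dcube R).indicator ω))

/-- The global testing constant `⟦σ,ω⟧^Glo_{τ,p,q}
= sup_{R : ω(R)>0} ω(R)^{-1/q'} ‖T^out_{τ,R}(1_R ω)‖_{L^{p'}(σ)}`. -/
def gloTest {d : ℕ} (p q : ℝ) (τ : DIdx d → ℝ≥0∞) (σ ω : (Fin d → ℝ) → ℝ≥0∞) : ℝ≥0∞ :=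
  ⨆ (R : DIdx d) (_ : wMeasure ω (dcube R) ≠ 0),
    wMeasure ω (dcube R) ^ (-(1 / (q / (q - 1)))) *
      lpn (p / (p - 1)) (wMeasure σ) (TdyOut τ R ((dcube R).indicator ω))

/-- The least weak-type `L^p(σ) → L^{q,∞}(ω)` constant of `f ↦ T_τ(fσ)`. -/
def weakConst {d : ℕ} (p q : ℝ) (τ : DIdx d → ℝ≥0∞) (σ ω : (Fin d → ℝ) → ℝ≥0∞) : ℝ≥0∞ :=
  sInf {N : ℝ≥0∞ | ∀ f : (Fin d → ℝ) → ℝ≥0∞, Measurable f → lpn p (wMeasure σ) f ≠ ⊤ →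
    ∀ lam : ℝ≥0∞, 0 < lam →
      wMeasure ω {x | lam < Tdy τ (fun y => f y * σ y) x} ≤
        (N * lpn p (wMeasure σ) f / lam) ^ q}


theorem measurableSet_dcube {d : ℕ} (i : DIdx d) : MeasurableSet (dcube i) := by
  have h : dcube i = Set.univ.pi fun j =>
      Set.Ico ((2 : ℝ) ^ i.1 * (i.2 j : ℝ)) ((2 : ℝ) ^ i.1 * ((i.2 j : ℝ) + 1)) := by
    ext x
    simp [dcube]
  rw [h]
  exact MeasurableSet.univ_pi fun _ => measurableSet_Ico

theorem measurable_Tdy {d : ℕ} (τ : DIdx d → ℝ≥0∞) (f : (Fin d → ℝ) → ℝ≥0∞) :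
    Measurable (Tdy τ f) :=
  Measurable.tsum fun i => measurable_const.indicator (measurableSet_dcube i)

theorem measurable_TdyIn {d : ℕ} (τ : DIdx d → ℝ≥0∞) (R : DIdx d) (f : (Fin d → ℝ) → ℝ≥0∞) :
    Measurable (TdyIn τ R f) :=
  Measurable.tsum fun i => measurable_const.indicator (measurableSet_dcube i.1)

theorem TdyIn_eq_zero_of_notMem {d : ℕ} (τ : DIdx d → ℝ≥0∞) (R : DIdx d)
    (f : (Fin d → ℝ) → ℝ≥0∞) {x : Fin d → ℝ} (hx : x ∉ dcube R) : TdyIn τ R f x = 0 := by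
  rw [TdyIn, ENNReal.tsum_eq_zero]
  intro i
  exact Set.indicator_of_notMem (fun h => hx (i.2 h)) _

/-- Duality between the local part of `T_τ` and `T_τ` itself. -/
theorem lintegral_mul_TdyIn_le {d : ℕ} (τ : DIdx d → ℝ≥0∞) {σ ω f : (Fin d → ℝ) → ℝ≥0∞}
    (hσ : Measurable σ) (hf : Measurable f) (R : DIdx d) :
    ∫⁻ x, f x * TdyIn τ R ((dcube R).indicator ω) x ∂(wMeasure σ) ≤
      ∫⁻ x in dcube R, Tdy τ (fun y => f y * σ y) x ∂(wMeasure ω) := by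
  have hT := measurable_TdyIn τ R ((dcube R).indicator ω)
  have hL : ∫⁻ x, f x * TdyIn τ R ((dcube R).indicator ω) x ∂(wMeasure σ) =
      ∑' i : {i : DIdx d // dcube i ⊆ dcube R},
        τ i.1 * lavg i.1 ((dcube R).indicator ω) * ∫⁻ x in dcube i.1, f x * σ x := by
    rw [wMeasure, lintegral_withDensity_eq_lintegral_mul _ hσ
      (g := fun x => f x * TdyIn τ R ((dcube R).indicator ω) x) (hf.mul hT)]
    have hpt : ∀ x, (σ * fun x => f x * TdyIn τ R ((dcube R).indicator ω) x) x =
        ∑' i : {i : DIdx d // dcube i ⊆ dcube R}, τ i.1 * lavg i.1 ((dcube R).indicator ω) *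
          (dcube i.1).indicator (fun y => f y * σ y) x := by
      intro x
      rw [Pi.mul_apply, TdyIn, ← ENNReal.tsum_mul_left, ← ENNReal.tsum_mul_left]
      refine tsum_congr fun i => ?_
      by_cases hx : x ∈ dcube i.1
      · simp only [Set.indicator_of_mem hx]
        ring
      · simp [Set.indicator_of_notMem hx]
    have hm : ∀ i : DIdx d, Measurable ((dcube i).indicator fun y => f y * σ y) :=
      fun i => (hf.mul hσ).indicator (measurableSet_dcube i)
    rw [lintegral_congr hpt, lintegral_tsum]
    · refine tsum_congr fun i => ?_
      rw [lintegral_const_mul _ (hm i.1), lintegral_indicator (measurableSet_dcube i.1)]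
    · intro i
      exact (Measurable.const_mul (hm i.1) _).aemeasurable
  have hR : ∫⁻ x in dcube R, Tdy τ (fun y => f y * σ y) x ∂(wMeasure ω) =
      ∑' i : DIdx d, τ i * lavg i (fun y => f y * σ y) * wMeasure ω (dcube i ∩ dcube R) := by
    unfold Tdy
    rw [lintegral_tsum fun i =>
      (measurable_const.indicator (measurableSet_dcube i)).aemeasurable]
    refine tsum_congr fun i => ?_
    rw [lintegral_indicator_const (measurableSet_dcube i),
      Measure.restrict_apply (measurableSet_dcube i)]
  rw [hL, hR]
  refine le_trans (le_of_eq (tsum_congr fun i => ?_))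
    (ENNReal.tsum_comp_le_tsum_of_injective Subtype.val_injective
      fun i : DIdx d => τ i * lavg i (fun y => f y * σ y) * wMeasure ω (dcube i ∩ dcube R))
  have hω : ∫⁻ x in dcube i.1, (dcube R).indicator ω x = wMeasure ω (dcube i.1) := by
    rw [wMeasure, withDensity_apply _ (measurableSet_dcube i.1)]
    exact setLIntegral_congr_fun (measurableSet_dcube i.1)
      fun x hx => Set.indicator_of_mem (i.2 hx) _
  rw [Set.inter_eq_left.2 i.2, lavg, lavg, cavg, cavg, hω, div_eq_mul_inv, div_eq_mul_inv]
  ring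

/-- Kolmogorov's inequality: a weak-type bound for `h` controls its integral
over a set of measure `m`. -/
theorem lintegral_le_of_weak_type {α : Type*} [MeasurableSpace α] {μ : Measure α} {q : ℝ}
    (hq : 1 < q) {h : α → ℝ≥0∞} (hh : Measurable h) {m B : ℝ≥0∞} (hm : μ Set.univ = m)
    (hm0 : m ≠ 0) (hmt : m ≠ ⊤)
    (hw : ∀ lam : ℝ≥0∞, 0 < lam → μ {x | lam < h x} ≤ (B / lam) ^ q) :
    ∫⁻ x, h x ∂μ ≤ (1 + 2 * ∑' k : ℕ, ((2 : ℝ≥0∞) ^ (1 - q)) ^ k) * B * m ^ (1 / (q / (q - 1))) := by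
  have hq0 : 0 < q := by linarith
  set S : ℝ≥0∞ := 1 + 2 * ∑' k : ℕ, ((2 : ℝ≥0∞) ^ (1 - q)) ^ k with hS
  have hexp : 1 / (q / (q - 1)) = 1 - 1 / q := by
    have : q - 1 ≠ 0 := by linarith
    field_simp
  have hS0 : S ≠ 0 := by simp [hS]
  have hmr0 : m ^ (1 / (q / (q - 1))) ≠ 0 := by simp [ENNReal.rpow_eq_zero_iff, hm0, hmt]
  have hmrt : m ^ (1 / (q / (q - 1))) ≠ ⊤ := ENNReal.rpow_ne_top_of_ne_zero hm0 hmt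
  have key : ∀ B' : ℝ≥0∞, B < B' → ∫⁻ x, h x ∂μ ≤ S * B' * m ^ (1 / (q / (q - 1))) := by
    intro B' hB'
    have hB0 : B' ≠ 0 := (pos_of_gt hB').ne'
    rcases eq_or_ne B' ⊤ with rfl | hBt
    · rw [ENNReal.mul_top hS0, ENNReal.top_mul hmr0]
      exact le_top
    set l : ℝ≥0∞ := B' * m ^ (-(1 / q)) with hl
    have hl0 : l ≠ 0 := mul_ne_zero hB0 (by simp [ENNReal.rpow_eq_zero_iff, hm0, hmt])
    have hlt : l ≠ ⊤ := ENNReal.mul_ne_top hBt (ENNReal.rpow_ne_top_of_ne_zero hm0 hmt)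
    have hlm : l * m = B' * m ^ (1 / (q / (q - 1))) := by
      rw [hl, hexp, mul_assoc, show 1 - 1 / q = -(1 / q) + 1 by ring,
        ENNReal.rpow_add _ _ hm0 hmt, ENNReal.rpow_one]
    have hBl : B' / l = m ^ (1 / q) := by
      rw [hl, ENNReal.rpow_neg, div_eq_mul_inv, ENNReal.mul_inv (Or.inl hB0) (Or.inl hBt), inv_inv,
        ← mul_assoc, ENNReal.mul_inv_cancel hB0 hBt, one_mul]
    have hpt : ∀ x, h x ≤ l + ∑' k : ℕ,
        {x | l * 2 ^ k < h x}.indicator (fun _ => l * 2 ^ (k + 1)) x := by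
      intro x
      have hstep : ∀ n : ℕ, min (h x) (l * 2 ^ n) ≤ l + ∑ k ∈ Finset.range n,
          {x | l * 2 ^ k < h x}.indicator (fun _ => l * 2 ^ (k + 1)) x := by
        intro n
        induction n with
        | zero => simp
        | succ n ih =>
          rw [Finset.sum_range_succ]
          by_cases hx : l * 2 ^ n < h x
          · rw [Set.indicator_of_mem (by exact hx)]
            exact (min_le_right _ _).trans (le_add_left le_add_self)
          · rw [Set.indicator_of_notMem (by exact hx), add_zero]
            rw [min_eq_left (not_lt.1 hx)] at ih
            exact (min_le_left _ _).trans ih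
      have hle : ∀ n : ℕ, min (h x) (l * 2 ^ n) ≤ l + ∑' k : ℕ,
          {x | l * 2 ^ k < h x}.indicator (fun _ => l * 2 ^ (k + 1)) x := fun n =>
        (hstep n).trans (add_le_add le_rfl (ENNReal.sum_le_tsum _))
      by_contra! hcon
      have htop : Filter.Tendsto (fun n : ℕ => l * (2 : ℝ≥0∞) ^ n) Filter.atTop (nhds ⊤) := by
        have := ENNReal.Tendsto.const_mul (a := l)
          (ENNReal.tendsto_pow_atTop_nhds_top_iff.2 (by norm_num : (1 : ℝ≥0∞) < 2))
          (Or.inl ENNReal.top_ne_zero)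
        rwa [ENNReal.mul_top hl0] at this
      obtain ⟨n, hn⟩ := (htop.eventually (lt_mem_nhds (lt_top_of_lt hcon))).exists
      exact absurd (hle n) (not_le.2 (lt_min hcon hn))
    have hms : ∀ k : ℕ, MeasurableSet {x | l * 2 ^ k < h x} := fun k =>
      measurableSet_lt measurable_const hh
    have hterm : ∀ k : ℕ, l * 2 ^ (k + 1) * μ {x | l * 2 ^ k < h x} ≤
        l * m * (2 * ((2 : ℝ≥0∞) ^ (1 - q)) ^ k) := by
      intro k
      have h2 : (2 : ℝ≥0∞) ^ k ≠ 0 := by positivity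
      have h2t : (2 : ℝ≥0∞) ^ k ≠ ⊤ := by finiteness
      have h1 : μ {x | l * 2 ^ k < h x} ≤ m * ((2 : ℝ≥0∞) ^ k) ^ (-q) := by
        refine (hw _ (pos_iff_ne_zero.2 (mul_ne_zero hl0 h2))).trans ?_
        have hdiv : B / (l * 2 ^ k) ≤ m ^ (1 / q) * ((2 : ℝ≥0∞) ^ k)⁻¹ := by
          rw [← hBl, div_eq_mul_inv, div_eq_mul_inv,
            ENNReal.mul_inv (Or.inl hl0) (Or.inl hlt), mul_assoc]
          gcongr
        refine (ENNReal.rpow_le_rpow hdiv hq0.le).trans (le_of_eq ?_)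
        rw [ENNReal.mul_rpow_of_nonneg _ _ hq0.le, ← ENNReal.rpow_mul,
          one_div_mul_cancel hq0.ne', ENNReal.rpow_one, ENNReal.inv_rpow, ENNReal.rpow_neg]
      have h3 : ((2 : ℝ≥0∞) ^ (1 - q)) ^ k = 2 ^ k * ((2 : ℝ≥0∞) ^ k) ^ (-q) := by
        rw [← ENNReal.rpow_natCast, ← ENNReal.rpow_mul, mul_comm, ENNReal.rpow_mul,
          ENNReal.rpow_natCast, sub_eq_add_neg, ENNReal.rpow_add _ _ h2 h2t, ENNReal.rpow_one]
      calc l * 2 ^ (k + 1) * μ {x | l * 2 ^ k < h x}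
          ≤ l * 2 ^ (k + 1) * (m * ((2 : ℝ≥0∞) ^ k) ^ (-q)) := by gcongr
        _ = l * m * (2 * ((2 : ℝ≥0∞) ^ (1 - q)) ^ k) := by rw [h3]; ring
    calc ∫⁻ x, h x ∂μ
        ≤ ∫⁻ x, (l + ∑' k : ℕ,
            {x | l * 2 ^ k < h x}.indicator (fun _ => l * 2 ^ (k + 1)) x) ∂μ :=
          lintegral_mono hpt
      _ = l * m + ∑' k : ℕ, l * 2 ^ (k + 1) * μ {x | l * 2 ^ k < h x} := by
          rw [lintegral_add_left measurable_const, lintegral_const, hm,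
            lintegral_tsum fun k => (measurable_const.indicator (hms k)).aemeasurable]
          congr 1
          exact tsum_congr fun k => lintegral_indicator_const (hms k) _
      _ ≤ l * m + ∑' k : ℕ, l * m * (2 * ((2 : ℝ≥0∞) ^ (1 - q)) ^ k) :=
          add_le_add le_rfl (ENNReal.tsum_le_tsum hterm)
      _ = S * (l * m) := by
          rw [ENNReal.tsum_mul_left, ENNReal.tsum_mul_left, hS]
          ring
      _ = S * B' * m ^ (1 / (q / (q - 1))) := by rw [hlm, mul_assoc]
  have hSt : S ≠ ⊤ := by
    have hr : (2 : ℝ≥0∞) ^ (1 - q) < 1 :=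
      ENNReal.rpow_lt_one_of_one_lt_of_neg (by norm_num) (by linarith)
    rw [hS, ENNReal.tsum_geometric]
    have : (1 - (2 : ℝ≥0∞) ^ (1 - q))⁻¹ ≠ ⊤ := ENNReal.inv_ne_top.2 (tsub_pos_of_lt hr).ne'
    finiteness
  set K : ℝ≥0∞ := S * m ^ (1 / (q / (q - 1))) with hK
  have hK0 : K ≠ 0 := mul_ne_zero hS0 hmr0
  have hKt : K ≠ ⊤ := ENNReal.mul_ne_top hSt hmrt
  have hfin : (∫⁻ x, h x ∂μ) / K ≤ B := by
    refine le_of_forall_gt_imp_ge_of_dense fun B' hB' => ?_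
    rw [ENNReal.div_le_iff hK0 hKt]
    refine (key B' hB').trans (le_of_eq ?_)
    rw [hK]
    ring
  rw [ENNReal.div_le_iff hK0 hKt] at hfin
  refine hfin.trans (le_of_eq ?_)
  rw [hK]
  ring

/-- Converse Hölder inequality for a function supported on a set of finite measure. -/
theorem lpn_le_of_forall_lintegral_mul_le {d : ℕ} {p : ℝ} (hp : 1 < p)
    {μ : Measure (Fin d → ℝ)} {E : Set (Fin d → ℝ)} (hE : MeasurableSet E) (hμE : μ E ≠ ⊤)
    {g : (Fin d → ℝ) → ℝ≥0∞} (hg : Measurable g) (hgE : ∀ x ∉ E, g x = 0) {A : ℝ≥0∞}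
    (hA : ∀ f : (Fin d → ℝ) → ℝ≥0∞, Measurable f → lpn p μ f ≠ ⊤ →
      ∫⁻ x, f x * g x ∂μ ≤ A * lpn p μ f) :
    lpn (p / (p - 1)) μ g ≤ A := by
  have hp1 : 0 < p - 1 := by linarith
  have hp0 : 0 < p := by linarith
  set r : ℝ := p / (p - 1) with hr
  have hr0 : 0 < r := div_pos hp0 hp1
  have hr1 : 0 < r - 1 := by
    have : r - 1 = 1 / (p - 1) := by rw [hr]; field_simp; ring
    rw [this]
    positivity
  have hrp : (r - 1) * p = r := by rw [hr]; field_simp; ring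
  have hrinv : 1 / r = 1 - 1 / p := by rw [hr]; field_simp
  have htrunc : ∀ n : ℕ, ∫⁻ x, min (g x) n ^ r ∂μ ≤ A ^ r := by
    intro n
    set X := ∫⁻ x, min (g x) n ^ r ∂μ with hX
    have hgn : Measurable fun x => min (g x) (n : ℝ≥0∞) := hg.min measurable_const
    have hXt : X ≠ ⊤ := by
      have hle : X ≤ ∫⁻ x, E.indicator (fun _ => (n : ℝ≥0∞) ^ r) x ∂μ := by
        refine lintegral_mono fun x => ?_
        by_cases hx : x ∈ E
        · rw [Set.indicator_of_mem hx]
          exact ENNReal.rpow_le_rpow (min_le_right _ _) hr0.le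
        · simp [hgE x hx, hr0]
      rw [lintegral_indicator_const hE] at hle
      exact ne_top_of_le_ne_top (ENNReal.mul_ne_top (by finiteness) hμE) hle
    have hlp : lpn p μ (fun x => min (g x) (n : ℝ≥0∞) ^ (r - 1)) = X ^ (1 / p) := by
      simp only [lpn, ← ENNReal.rpow_mul, hrp, hX]
    have hXA : X ≤ A * X ^ (1 / p) := by
      rw [← hlp]
      refine le_trans (lintegral_mono fun x => ?_) (hA _ (hgn.pow_const _) ?_)
      · calc min (g x) (n : ℝ≥0∞) ^ r
            = min (g x) (n : ℝ≥0∞) ^ (r - 1) * min (g x) (n : ℝ≥0∞) ^ (1 : ℝ) := by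
              rw [← ENNReal.rpow_add_of_nonneg _ _ hr1.le zero_le_one, sub_add_cancel]
          _ ≤ min (g x) (n : ℝ≥0∞) ^ (r - 1) * g x := by
              rw [ENNReal.rpow_one]
              gcongr
              exact min_le_left _ _
      · rw [hlp]
        exact ENNReal.rpow_ne_top_of_nonneg (by positivity) hXt
    rcases eq_or_ne X 0 with h0 | h0
    · rw [h0]
      exact zero_le
    have hXr : X ^ (1 / r) ≤ A := by
      rw [hrinv, ENNReal.rpow_sub _ _ h0 hXt, ENNReal.rpow_one]
      exact ENNReal.div_le_of_le_mul hXA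
    calc X = (X ^ (1 / r)) ^ r := by
          rw [← ENNReal.rpow_mul, one_div_mul_cancel hr0.ne', ENNReal.rpow_one]
      _ ≤ A ^ r := ENNReal.rpow_le_rpow hXr hr0.le
  have hlim : ∫⁻ x, g x ^ r ∂μ ≤ A ^ r := by
    have hpt : ∀ x, g x ^ r = ⨆ n : ℕ, min (g x) (n : ℝ≥0∞) ^ r := by
      intro x
      refine (tendsto_nhds_unique (tendsto_atTop_iSup fun a b hab => ?_) ?_).symm
      · gcongr
      · refine (ENNReal.continuous_rpow_const.tendsto _).comp ?_
        have := (tendsto_const_nhds (x := g x)).min ENNReal.tendsto_nat_nhds_top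
        rwa [min_eq_left le_top] at this
    simp_rw [hpt]
    rw [lintegral_iSup]
    · exact iSup_le htrunc
    · exact fun n => (hg.min measurable_const).pow_const _
    · intro a b hab x
      dsimp only
      gcongr
  calc lpn r μ g ≤ (A ^ r) ^ (1 / r) := ENNReal.rpow_le_rpow hlim (by positivity)
    _ = A := by rw [← ENNReal.rpow_mul, mul_one_div_cancel hr0.ne', ENNReal.rpow_one]

/-- **Necessity of the local testing condition.** -/
theorem stmt8 (d : ℕ) (p q : ℝ) (hp : 1 < p) (hpq : p ≤ q) :
    ∃ C : ℝ≥0∞, 0 < C ∧ C < ⊤ ∧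
      ∀ (τ : DIdx d → ℝ≥0∞) (σ ω : (Fin d → ℝ) → ℝ≥0∞),
        Measurable σ → Measurable ω →
        (∀ i : DIdx d, wMeasure σ (dcube i) ≠ ⊤) →
        (∀ i : DIdx d, wMeasure ω (dcube i) ≠ ⊤) →
        ∀ N : ℝ≥0∞, N ≠ ⊤ →
          (∀ f : (Fin d → ℝ) → ℝ≥0∞, Measurable f → lpn p (wMeasure σ) f ≠ ⊤ →
            ∀ lam : ℝ≥0∞, 0 < lam →
              wMeasure ω {x | lam < Tdy τ (fun y => f y * σ y) x} ≤
                (N * lpn p (wMeasure σ) f / lam) ^ q) →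
          ∀ R : DIdx d, wMeasure ω (dcube R) ≠ 0 →
            lpn (p / (p - 1)) (wMeasure σ) (TdyIn τ R ((dcube R).indicator ω)) ≤
              C * N * wMeasure ω (dcube R) ^ (1 / (q / (q - 1))) := by
  have hq : 1 < q := hp.trans_le hpq
  have hr : (2 : ℝ≥0∞) ^ (1 - q) < 1 :=
    ENNReal.rpow_lt_one_of_one_lt_of_neg (by norm_num) (by linarith)
  refine ⟨1 + 2 * ∑' k : ℕ, ((2 : ℝ≥0∞) ^ (1 - q)) ^ k, by positivity, ?_, ?_⟩
  · rw [ENNReal.tsum_geometric]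
    have : (1 - (2 : ℝ≥0∞) ^ (1 - q))⁻¹ ≠ ⊤ := ENNReal.inv_ne_top.2 (tsub_pos_of_lt hr).ne'
    finiteness
  · intro τ σ ω hσ _ hσfin hωfin N _ hw R hR
    refine lpn_le_of_forall_lintegral_mul_le hp (measurableSet_dcube R) (hσfin R)
      (measurable_TdyIn τ R _) (fun x hx => TdyIn_eq_zero_of_notMem τ R _ hx) ?_
    intro f hf hft
    refine (lintegral_mul_TdyIn_le τ hσ hf R).trans ?_
    refine (lintegral_le_of_weak_type hq (measurable_Tdy τ _)
      (Measure.restrict_apply_univ _) hR (hωfin R)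
      fun lam hlam => (Measure.restrict_apply_le _ _).trans (hw f hf hft lam hlam)).trans
      (le_of_eq ?_)
    ring
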